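/- Let k ≥ 3 and s ≥ 2k² be integers, let ℓ be an integer with 1 ≤ ℓ ≤ k − 1, and let γ > 0. Let H be a k-graph on n vertices, let X = {x₁,…,x_k} be a set of k distinct vertices of H, and for 1 ≤ i ≤ k let N_i = N_H(X ∖ {x_i}) be the set of vertices v ∈ V(H) ∖ (X ∖ {x_i}) with (X ∖ {x_i}) ∪ {v} ∈ E(H). Suppose |N_i| ≥ (1/2 + 1/(2s) + γ)n for all 1 ≤ i ≤ k. Let G_X be the graph on vertex set {N₁,…,N_k} in which N_i N_j is an edge if and only if |N_i ∩ N_j| ≤ (ℓ/s + γ)n. Then G_X is bipartite. -/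

import Mathlib

set_option autoImplicit false

open Finset

section Defs

variable {V : Type} [Fintype V] [DecidableEq V]

/-- `E` is the edge set of a `k`-uniform hypergraph on `V`. -/
def IsKGraph (k : ℕ) (E : Finset (Finset V)) : Prop := ∀ e ∈ E, e.card = k

/-- The degree of a vertex set `S`: the number of edges containing `S`. -/
def degS (E : Finset (Finset V)) (S : Finset V) : ℕ := (E.filter fun e => S ⊆ e).card

/-- `C` is the (cyclically ordered) vertex list of a copy of a tight cycle:
the vertices are distinct and every `k` cyclically consecutive vertices form an edge. -/
def IsTightCycleList (k : ℕ) (E : Finset (Finset V)) (C : List V) : Prop :=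
  C.Nodup ∧ ∀ i < C.length, (((C ++ C).drop i).take k).toFinset ∈ E

/-- `H` has a `C_s^k`-covering: every vertex lies in a copy of the tight cycle on `s` vertices. -/
def HasCsCovering (k s : ℕ) (E : Finset (Finset V)) : Prop :=
  ∀ v : V, ∃ C : List V, C.length = s ∧ IsTightCycleList k E C ∧ v ∈ C

/-- `H` contains a copy of `C_s^k`. -/
def HasCsCopy (k s : ℕ) (E : Finset (Finset V)) : Prop :=
  ∃ C : List V, C.length = s ∧ IsTightCycleList k E C

/-- `A` is the vertex set of a copy of `C_s^k` in `H`. -/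
def SpansCs (k s : ℕ) (E : Finset (Finset V)) (A : Finset V) : Prop :=
  ∃ C : List V, C.length = s ∧ IsTightCycleList k E C ∧ C.toFinset = A

/-- a `C_s^k`-tiling: a set of pairwise disjoint vertex sets of copies of `C_s^k`. -/
def IsCsTiling (k s : ℕ) (E : Finset (Finset V)) (T : Finset (Finset V)) : Prop :=
  (T : Set (Finset V)).PairwiseDisjoint id ∧ ∀ A ∈ T, SpansCs k s E A

/-- a perfect `C_s^k`-tiling of the induced subgraph on `U`. -/
def HasPerfectCsTilingOn (k s : ℕ) (E : Finset (Finset V)) (U : Finset V) : Prop :=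
  ∃ T : Finset (Finset V), IsCsTiling k s E T ∧ T.biUnion id = U

/-- a perfect `C_s^k`-tiling of `H`. -/
def HasPerfectCsTiling (k s : ℕ) (E : Finset (Finset V)) : Prop :=
  HasPerfectCsTilingOn k s E Finset.univ

/-- the pair `(k,s)` is admissible if `gcd k s = 1` or `k / gcd k s` is even. -/
def AdmissiblePair (k s : ℕ) : Prop := Nat.gcd k s = 1 ∨ Even (k / Nat.gcd k s)

/-- The `k`-graph `H₀^k(A,B)`: edges are the `k`-subsets `e` of `A ∪ B`
with `|e ∩ A| ≢ k (mod 2)`. -/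
def H0edges (k : ℕ) (A B : Finset V) : Finset (Finset V) :=
  ((A ∪ B).powersetCard k).filter fun e => ¬ (e ∩ A).card % 2 = k % 2

/-- `P` is (the vertex list of) a tight path: distinct vertices, every `k`
consecutive vertices form an edge. -/
def IsTightPath (k : ℕ) (E : Finset (Finset V)) (P : List V) : Prop :=
  P.Nodup ∧ ∀ i, i + k ≤ P.length → ((P.drop i).take k).toFinset ∈ E

/-- `P = v₁ ⋯ v_ℓ` has start of type `σ` w.r.t. classes `Vc`: `v_i ∈ V_{σ(i)}`
for `1 ≤ i ≤ k-1` (0-indexed below). -/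
def hasStartType (k : ℕ) (Vc : Fin k → Finset V) (P : List V) (σ : Equiv.Perm (Fin k)) : Prop :=
  k ≤ P.length + 1 ∧ ∀ j : Fin k, (j : ℕ) + 1 < k → ∀ v ∈ P[(j : ℕ)]?, v ∈ Vc (σ j)

/-- `P = v₁ ⋯ v_ℓ` has end of type `σ` w.r.t. classes `Vc`: `v_{ℓ-k+i} ∈ V_{σ(i)}`
for `2 ≤ i ≤ k` (0-indexed below). -/
def hasEndType (k : ℕ) (Vc : Fin k → Finset V) (P : List V) (σ : Equiv.Perm (Fin k)) : Prop :=
  k ≤ P.length + 1 ∧ ∀ j : Fin k, (j : ℕ) ≠ 0 →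
    ∀ v ∈ P[(P.length + (j : ℕ) - k)]?, v ∈ Vc (σ j)

/-- `Vc` are the classes of a complete `(k,k)`-graph in `H`: nonempty, pairwise disjoint,
and every transversal is an edge. -/
def IsCompletePartite (k : ℕ) (E : Finset (Finset V)) (Vc : Fin k → Finset V) : Prop :=
  (∀ i, (Vc i).Nonempty) ∧ (∀ i j, i ≠ j → Disjoint (Vc i) (Vc j)) ∧
  ∀ g : Fin k → V, (∀ i, g i ∈ Vc i) → Finset.image g Finset.univ ∈ E

/-- the cyclic permutation `τ = (1 2 ⋯ k)` (0-indexed: `j ↦ j + 1 mod k`). -/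
def cyc (k : ℕ) : Equiv.Perm (Fin k) := finRotate k

/-- `W` is a `G`-gadget for the complete `(k,k)`-graph with classes `Vc` avoiding `S`. -/
def IsGadget (k : ℕ) (E : Finset (Finset V)) (Vc : Fin k → Finset V)
    (G : SimpleGraph (Fin k)) (S : Finset V) (W : Fin k → Fin k → Finset V) : Prop :=
  (∀ i j, G.Adj i j → W i j = W j i) ∧
  (∀ i j, G.Adj i j →
    (W i j).card = 2 * k - 1 ∧
    (W i j \ Finset.univ.biUnion Vc).card = 1 ∧
    Disjoint (W i j) S ∧
    (∀ i' : Fin k, (W i j ∩ Vc i').card = if i' = i ∨ i' = j then 1 else 2) ∧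
    (∀ σ : Equiv.Perm (Fin k), (∃ z : Fin k, (z : ℕ) = 0 ∧ (σ z = i ∨ σ z = j)) →
      ∃ Q : List V, IsTightPath k E Q ∧ Q.toFinset = W i j ∧
        hasStartType k Vc Q (σ * cyc k) ∧ hasEndType k Vc Q (Equiv.swap i j * σ))) ∧
  (∀ i j i' j', G.Adj i j → G.Adj i' j' → ({i, j} : Finset (Fin k)) ≠ {i', j'} →
    Disjoint (W i j) (W i' j'))

open Classical in
/-- the set of vertices `w_{ij}`, `ij ∈ E(G)`, of a gadget `W`. -/
noncomputable def gadgetVerts (k : ℕ) (Vc : Fin k → Finset V)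
    (G : SimpleGraph (Fin k)) (W : Fin k → Fin k → Finset V) : Finset V :=
  (Finset.univ.filter fun p : Fin k × Fin k => G.Adj p.1 p.2).biUnion
    fun p => W p.1 p.2 \ Finset.univ.biUnion Vc

/-- the graph on `[k]` consisting of the paths given by the lists in `L`. -/
def pathsGraph (k : ℕ) (L : List (List (Fin k))) : SimpleGraph (Fin k) :=
  SimpleGraph.fromEdgeSet {e | ∃ l ∈ L, ∃ p ∈ l.zip l.tail, e = s(p.1, p.2)}

/-- `G` is a vertex-disjoint union of paths. -/
def IsUnionOfPaths (k : ℕ) (G : SimpleGraph (Fin k)) : Prop :=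
  ∃ L : List (List (Fin k)), (∀ l ∈ L, l.Nodup) ∧
    L.Pairwise (fun l₁ l₂ => ∀ a ∈ l₁, ∀ b ∈ l₂, a ≠ b) ∧ G = pathsGraph k L

/-- `m(σ)` (1-indexed), read off from the normalized cycle decomposition `L` of `σ`:
the last element of the last cycle, or `1` if `L` is empty. -/
def mOf (k : ℕ) (L : List (List (Fin k))) : ℕ :=
  ((L.getLast?.bind List.getLast?).map (fun x => (x : ℕ) + 1)).getD 1

/-- `L` is the normalized cycle decomposition of `σ`: disjoint cycles of length ≥ 2,
each cycle listed ending with its minimal element, the cycles ordered by increasing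
last elements. -/
def IsNormCycleDecomp (k : ℕ) (σ : Equiv.Perm (Fin k)) (L : List (List (Fin k))) : Prop :=
  (∀ l ∈ L, 2 ≤ l.length ∧ l.Nodup) ∧
  L.Pairwise (fun l₁ l₂ => ∀ a ∈ l₁, ∀ b ∈ l₂, a ≠ b) ∧
  σ = (L.map List.formPerm).prod ∧
  (∀ l ∈ L, ∀ a ∈ l.getLast?, ∀ b ∈ l, a ≤ b) ∧
  L.Pairwise (fun l₁ l₂ => ∀ a ∈ l₁.getLast?, ∀ b ∈ l₂.getLast?, a < b)

/-- `H` is `(μ, θ)`-dense. -/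
def IsDense (k : ℕ) (μ θ : ℝ) (E : Finset (Finset V)) : Prop :=
  ∃ 𝒮 : Finset (Finset V), (∀ S ∈ 𝒮, S.card = k - 1) ∧
    (𝒮.card : ℝ) ≤ θ * ((Fintype.card V).choose (k - 1)) ∧
    ∀ S : Finset V, S.card = k - 1 → S ∉ 𝒮 →
      μ * ((Fintype.card V : ℝ) - k + 1) ≤ (degS E S : ℝ)

/-- `H` is strongly `(μ, θ)`-dense. -/
def IsStronglyDense (k : ℕ) (μ θ : ℝ) (E : Finset (Finset V)) : Prop :=
  IsDense k μ θ E ∧ ∀ e ∈ E, ∀ X ⊆ e, X.card = k - 1 →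
    μ * ((Fintype.card V : ℝ) - k + 1) ≤ (degS E X : ℝ)

/-- the vertex set of `F(K,G)` inside the ambient type: all core vertices, plus one
pendant vertex for each edge of `G`. -/
def FsVertexSet (k : ℕ) (a : Fin k → ℕ) (G : SimpleGraph (Fin k)) :
    Set ((Σ i : Fin k, Fin (a i)) ⊕ Sym2 (Fin k)) :=
  Set.range Sum.inl ∪ Sum.inr '' G.edgeSet

/-- the edges of `F(K,G)`, where `K = K^k(a)`: all transversals of the classes, plus,
for each edge `ij` of `G`, all `k`-sets consisting of the pendant vertex `w_{ij}` and one
vertex from each class other than `i` (resp. other than `j`). -/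
def FKGedges (k : ℕ) (a : Fin k → ℕ) (G : SimpleGraph (Fin k)) :
    Set (Finset ((Σ i : Fin k, Fin (a i)) ⊕ Sym2 (Fin k))) :=
  {e | (∃ g : ∀ i, Fin (a i), e = Finset.univ.image fun i => Sum.inl ⟨i, g i⟩) ∨
    (∃ i j, G.Adj i j ∧ ∃ g : ∀ i', Fin (a i'),
      e = insert (Sum.inr s(i, j)) ((Finset.univ.erase i).image fun i' => Sum.inl ⟨i', g i'⟩))}

/-- `F(K^k(a), G)` contains a spanning copy of the tight cycle `C_s^k`. -/
def FsHasSpanningCs (k s : ℕ) (a : Fin k → ℕ) (G : SimpleGraph (Fin k)) : Prop :=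
  ∃ C : List ((Σ i : Fin k, Fin (a i)) ⊕ Sym2 (Fin k)),
    C.Nodup ∧ C.length = s ∧ (↑C.toFinset : Set _) = FsVertexSet k a G ∧
    ∀ i < C.length, (((C ++ C).drop i).take k).toFinset ∈ FKGedges k a G

/-- `A` is the vertex set of a copy of `K^k(t)` in `H`. -/
def SpansEsCopy (k t : ℕ) (E : Finset (Finset V)) (A : Finset V) : Prop :=
  ∃ f : Fin k × Fin t → V, Function.Injective f ∧ Finset.univ.image f = A ∧
    ∀ g : Fin k → Fin t, (Finset.univ.image fun i => f (i, g i)) ∈ E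

/-- `A` is the vertex set of a copy of `F_s = F(K^k(a), G)` in `H`. -/
def SpansFsCopy (k : ℕ) (a : Fin k → ℕ) (G : SimpleGraph (Fin k))
    (E : Finset (Finset V)) (A : Finset V) : Prop :=
  ∃ f : ((Σ i : Fin k, Fin (a i)) ⊕ Sym2 (Fin k)) → V,
    Set.InjOn f (FsVertexSet k a G) ∧ f '' FsVertexSet k a G = ↑A ∧
    ∀ e ∈ FKGedges k a G, e.image f ∈ E

/-- `(TF, TE)` is an `{F_s, E_s}`-tiling of `H`, given as the families of vertex sets of
the copies of `F_s` and of `E_s = K^k(max_i a_i)`. -/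
def IsFETiling (k : ℕ) (a : Fin k → ℕ) (G : SimpleGraph (Fin k))
    (E : Finset (Finset V)) (TF TE : Finset (Finset V)) : Prop :=
  ((↑(TF ∪ TE) : Set (Finset V)).PairwiseDisjoint id) ∧
  (∀ A ∈ TF, SpansFsCopy k a G E A) ∧
  (∀ A ∈ TE, SpansEsCopy k (Finset.univ.sup a) E A)

/-- `φ(𝒯) = (n - s(|ℱ_𝒯| + (3/5)|ℰ_𝒯|))/n`. -/
noncomputable def phiTiling (s : ℕ) (TF TE : Finset (Finset V)) : ℝ :=
  ((Fintype.card V : ℝ) - s * ((TF.card : ℝ) + (3 / 5) * (TE.card : ℝ))) / (Fintype.card V : ℝ)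

/-- `φ(H)`: the minimum of `φ(𝒯)` over all `{F_s, E_s}`-tilings of `H`. -/
noncomputable def phiMin (k s : ℕ) (a : Fin k → ℕ) (G : SimpleGraph (Fin k))
    (E : Finset (Finset V)) : ℝ :=
  sInf {x | ∃ TF TE : Finset (Finset V), IsFETiling k a G E TF TE ∧ x = phiTiling s TF TE}

/-- `Φ(n, μ, θ)`: the maximum of `φ(H)` over all `(μ,θ)`-dense `k`-graphs `H` on `n` vertices. -/
noncomputable def PhiMax (k s : ℕ) (a : Fin k → ℕ) (G : SimpleGraph (Fin k))
    (n : ℕ) (μ θ : ℝ) : ℝ :=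
  sSup {x | ∃ E : Finset (Finset (Fin n)), IsKGraph k E ∧ IsDense k μ θ E ∧
    x = phiMin k s a G E}

end Defs

/-- For sets `A 0, …, A m = A 0` arranged cyclically with `m` odd, no point can lie in half of the
sets without lying in two consecutive ones; summing over all points gives this bound. -/
theorem two_mul_sum_card_add_card_le {V : Type*} [Fintype V] [DecidableEq V]
    (A : ℕ → Finset V) {m : ℕ} (hm : Odd m) (h0 : A m = A 0) :
    2 * ∑ t ∈ range m, (A t).card + Fintype.card V ≤
      m * Fintype.card V + 2 * ∑ t ∈ range m, (A t ∩ A (t + 1)).card := by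
  have card_eq (S : Finset V) : S.card = ∑ v, if v ∈ S then 1 else 0 := by simp
  have pointwise (v : V) : 2 * (∑ t ∈ range m, if v ∈ A t then 1 else 0) + 1 ≤
      m + 2 * ∑ t ∈ range m, if v ∈ A t ∩ A (t + 1) then 1 else 0 := by
    have shift : (∑ t ∈ range m, if v ∈ A (t + 1) then 1 else 0) =
        ∑ t ∈ range m, if v ∈ A t then 1 else 0 := by
      have h := (sum_range_succ (fun t => if v ∈ A t then 1 else 0) m).symm.trans
        (sum_range_succ' (fun t => if v ∈ A t then 1 else 0) m)
      simp only [h0] at h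
      omega
    have step : (∑ t ∈ range m, ((if v ∈ A t then 1 else 0) + if v ∈ A (t + 1) then 1 else 0)) ≤
        ∑ t ∈ range m, (1 + if v ∈ A t ∩ A (t + 1) then 1 else 0) := by
      refine sum_le_sum fun t _ => ?_
      by_cases h₁ : v ∈ A t <;> by_cases h₂ : v ∈ A (t + 1) <;> simp [h₁, h₂]
    rw [sum_add_distrib, sum_add_distrib, shift, sum_const, card_range, smul_eq_mul] at step
    obtain ⟨r, rfl⟩ := hm
    omega
  have total := sum_le_sum fun v (_ : v ∈ (univ : Finset V)) => pointwise v
  rw [sum_add_distrib, sum_add_distrib, ← mul_sum, ← mul_sum, sum_comm,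
    sum_comm (s := univ) (t := range m)] at total
  simp only [← card_eq, sum_const, card_univ, smul_eq_mul, mul_one] at total
  rwa [mul_comm m]

/-- A closed walk of odd length can be shortened to one visiting each vertex at most once. -/
theorem SimpleGraph.Walk.exists_odd_length_le_card {W : Type*} [Fintype W] {G : SimpleGraph W}
    {u : W} (p : G.Walk u u) (hp : Odd p.length) :
    ∃ (w : W) (q : G.Walk w w), Odd q.length ∧ q.length ≤ Fintype.card W := by
  induction hn : p.length using Nat.strong_induction_on generalizing u with
  | _ n ih =>
    subst hn
    by_cases hle : p.length ≤ Fintype.card W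
    · exact ⟨u, p, hp, hle⟩
    obtain ⟨i, hi, j, hj, hij, heq⟩ : ∃ i < p.length, ∃ j < p.length, i < j ∧
        p.getVert i = p.getVert j := by
      obtain ⟨a, b, hab, h⟩ := Fintype.exists_ne_map_eq_of_card_lt
        (fun t : Fin p.length => p.getVert t) (by simpa using hle)
      rcases lt_or_gt_of_ne (Fin.val_ne_of_ne hab) with h' | h'
      · exact ⟨a, a.2, b, b.2, h', h⟩
      · exact ⟨b, b.2, a, a.2, h', h.symm⟩
    by_cases hodd : Odd (j - i)
    · refine ih (j - i) (by omega)
        (((p.drop i).take (j - i)).copy rfl ?_) ?_ ?_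
      · rw [SimpleGraph.Walk.drop_getVert, Nat.add_sub_cancel' hij.le, heq]
      · rw [SimpleGraph.Walk.length_copy, SimpleGraph.Walk.take_length,
          SimpleGraph.Walk.drop_length, min_eq_left (by omega)]
        exact hodd
      · rw [SimpleGraph.Walk.length_copy, SimpleGraph.Walk.take_length,
          SimpleGraph.Walk.drop_length, min_eq_left (by omega)]
    · have hlen : ((p.take i).append ((p.drop j).copy heq.symm rfl)).length =
          p.length - (j - i) := by
        rw [SimpleGraph.Walk.length_append, SimpleGraph.Walk.length_copy,
          SimpleGraph.Walk.take_length, SimpleGraph.Walk.drop_length, min_eq_left hi.le]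
        omega
      refine ih (p.length - (j - i)) (by omega) _ ?_ hlen
      rw [hlen, Nat.odd_sub (by omega)]
      simpa [hp] using hodd

/-- the auxiliary graph `G_X` on the neighbourhoods `N₁, …, N_k` (indexed by
`Fin k`), with `N_i N_j` an edge iff `|N_i ∩ N_j| ≤ (ℓ/s + γ)n`, is bipartite
(i.e. 2-colorable). -/
theorem bipartite_aux_graph {V : Type} [Fintype V] [DecidableEq V]
    (k s ℓ : ℕ) (hk : 3 ≤ k) (hs : 2 * k ^ 2 ≤ s) (hℓ1 : 1 ≤ ℓ) (hℓk : ℓ ≤ k - 1)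
    (γ : ℝ) (hγ : 0 < γ)
    (E : Finset (Finset V)) (hE : IsKGraph k E)
    (x : Fin k → V) (hx : Function.Injective x)
    (N : Fin k → Finset V)
    (hN : ∀ i, N i = Finset.univ.filter fun v =>
      v ∉ (Finset.univ.image x).erase (x i) ∧
        insert v ((Finset.univ.image x).erase (x i)) ∈ E)
    (hNcard : ∀ i, ((1 : ℝ) / 2 + 1 / (2 * (s : ℝ)) + γ) * (Fintype.card V : ℝ) ≤
      ((N i).card : ℝ)) :
    (SimpleGraph.fromRel fun i j : Fin k =>
      ((N i ∩ N j).card : ℝ) ≤ ((ℓ : ℝ) / (s : ℝ) + γ) * (Fintype.card V : ℝ)).Colorable 2 := by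
  rw [SimpleGraph.two_colorable_iff_forall_loop_even]
  intro u p
  by_contra hp
  obtain ⟨w, q, hq, hqk⟩ := p.exists_odd_length_le_card (Nat.not_even_iff_odd.mp hp)
  rw [Fintype.card_fin] at hqk
  have count := two_mul_sum_card_add_card_le (fun t => N (q.getVert t)) hq (by simp)
  have inter_le : ∀ t ∈ range q.length, ((N (q.getVert t) ∩ N (q.getVert (t + 1))).card : ℝ) ≤
      ((ℓ : ℝ) / s + γ) * Fintype.card V := by
    intro t ht
    have h := (q.adj_getVert_succ (mem_range.mp ht)).2
    simpa [inter_comm] using h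
  have lower := card_nsmul_le_sum (range q.length) (fun t => ((N (q.getVert t)).card : ℝ)) _
    fun t _ => hNcard (q.getVert t)
  have upper := sum_le_card_nsmul (range q.length) _ _ inter_le
  rw [card_range, nsmul_eq_mul] at lower upper
  generalize q.length = m at *
  have hV : 0 < (Fintype.card V : ℝ) := by
    have : Nonempty V := ⟨x ⟨0, by omega⟩⟩
    exact_mod_cast Fintype.card_pos
  have hs0 : (0 : ℝ) < s := by
    have : 0 < s := by nlinarith
    exact_mod_cast this
  have count' : 2 * (∑ t ∈ range m, ((N (q.getVert t)).card : ℝ)) + Fintype.card V ≤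
      m * Fintype.card V +
        2 * ∑ t ∈ range m, ((N (q.getVert t) ∩ N (q.getVert (t + 1))).card : ℝ) := by
    exact_mod_cast count
  have key : (m : ℝ) / s + 1 ≤ 2 * m * ℓ / s := by
    refine le_of_mul_le_mul_right ?_ hV
    linear_combination 2 * lower + count' + 2 * upper
  rw [div_add_one hs0.ne', div_le_div_iff_of_pos_right hs0] at key
  have key' : m + s ≤ 2 * m * ℓ := by exact_mod_cast key
  have : m * ℓ ≤ k * k := Nat.mul_le_mul hqk (by omega)
  have : 0 < m := hq.pos
  nlinarith
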